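/- Let x be an element of a unital associative ℚ(q)-algebra. Then for all m ∈ ℕ, all integers s, and all j with 1 ≤ j ≤ m: q^j · {x; s | m, j} · (q^{s−m+2j} x − 1) + (q^{2j} − 1) · {x; s | m, j−1} = (q^{m+1} − 1) · {x; s | m+1, j}. -/

import Mathlib

open Finset

noncomputable section

/-- The base field `ℚ(q)` of rational functions over `ℚ`. -/
abbrev K : Type := RatFunc ℚ

/-- The indeterminate `q`. -/
def q : K := RatFunc.X

/-- The `x`-number `(n)_x = (x^n - 1)/(x - 1)`. -/
def qn (x : K) (n : ℕ) : K := (x ^ n - 1) / (x - 1)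

/-- The `x`-factorial `(n)_x!`. -/
def qnFact (x : K) (n : ℕ) : K := ∏ r ∈ Finset.Icc 1 n, qn x r

/-- The `x`-binomial coefficient `binom_x(n,s)`, zero when `s > n`. -/
def qBinom (x : K) (n s : ℕ) : K :=
  if s ≤ n then qnFact x n / (qnFact x s * qnFact x (n - s)) else 0

/-- The balanced `q`-integer `[n]_q = (q^n - q^{-n})/(q - q^{-1})`. -/
def qint (n : ℕ) : K := (q ^ n - q⁻¹ ^ n) / (q - q⁻¹)

/-- The balanced `q`-factorial `[n]_q!`. -/
def qintFact (n : ℕ) : K := ∏ r ∈ Finset.Icc 1 n, qint r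

variable {A : Type*} [Ring A] [Algebra K A]

/-- The `q`-divided power `X^{(n)} = X^n / [n]_q!`. -/
def dp (X : A) (n : ℕ) : A := (qintFact n)⁻¹ • X ^ n

/-- The `q`-binomial coefficient `C_q(X; c, n) = ∏_{s=1}^n (q^{c+1-s} X - 1)/(q^s - 1)`. -/
def Cq (X : A) (c : ℤ) : ℕ → A
  | 0 => 1
  | n + 1 => (q ^ ((n : ℤ) + 1) - 1)⁻¹ • (Cq X c n * (q ^ (c - (n : ℤ)) • X - 1))

/-- The bracket `{X; c | n, r} = Σ_{s=0}^r q^{s(s+1)/2} binom_q(r,s) C_q(X; c+s, n-r)`. -/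
def Sq (X : A) (c : ℤ) (n r : ℕ) : A :=
  ∑ s ∈ Finset.range (r + 1),
    (q ^ (s * (s + 1) / 2) * qBinom q r s) • Cq X (c + (s : ℤ)) (n - r)

end

theorem q_ne_zero : q ≠ 0 := RatFunc.X_ne_zero

theorem q_pow_sub_one_ne_zero (n : ℕ) : q ^ (n + 1) - 1 ≠ 0 := by
  intro h
  have h1 : algebraMap (Polynomial ℚ) K (Polynomial.X ^ (n + 1)) =
      algebraMap (Polynomial ℚ) K 1 := by
    rw [map_pow, RatFunc.algebraMap_X, map_one]
    exact sub_eq_zero.mp h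
  have h2 := congrArg Polynomial.natDegree (RatFunc.algebraMap_injective ℚ h1)
  simp at h2

theorem q_sub_one_ne_zero : q - 1 ≠ 0 := by simpa using q_pow_sub_one_ne_zero 0

theorem qnFact_succ (x : K) (n : ℕ) :
    qnFact x (n + 1) = qnFact x n * ((x ^ (n + 1) - 1) / (x - 1)) :=
  Finset.prod_Icc_succ_top (by omega) _

theorem qnFact_q_ne_zero (n : ℕ) : qnFact q n ≠ 0 := by
  induction n with
  | zero => simp [qnFact]
  | succ n ih =>
    rw [qnFact_succ]
    exact mul_ne_zero ih (div_ne_zero (q_pow_sub_one_ne_zero n) q_sub_one_ne_zero)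

theorem qBinom_add (x : K) (t d : ℕ) :
    qBinom x (t + d) t = qnFact x (t + d) / (qnFact x t * qnFact x d) := by
  simp [qBinom]

theorem qBinom_self_succ (x : K) (n : ℕ) : qBinom x n (n + 1) = 0 := by
  simp [qBinom]

theorem qBinom_mul_q_pow_sub_one (t d : ℕ) :
    qBinom q (t + d) t * (q ^ d - 1) = qBinom q (t + d) (t + 1) * (q ^ (t + 1) - 1) := by
  cases d with
  | zero => simp [qBinom_self_succ]
  | succ d =>
    have e : t + (d + 1) = t + 1 + d := by omega
    have h := qBinom_add q (t + 1) d
    rw [← e] at h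
    rw [h, qBinom_add, qnFact_succ q t, qnFact_succ q d]
    have h1 := qnFact_q_ne_zero t
    have h2 := qnFact_q_ne_zero d
    have h3 := q_pow_sub_one_ne_zero t
    have h4 := q_pow_sub_one_ne_zero d
    have h5 := q_sub_one_ne_zero
    field_simp

theorem qBinom_pred_mul (k t d : ℕ) (h : k + 1 = t + d) :
    qBinom q k t * (q ^ (k + 1) - 1) = qBinom q (k + 1) t * (q ^ d - 1) := by
  cases d with
  | zero =>
    obtain rfl : t = k + 1 := by omega
    simp [qBinom_self_succ]
  | succ d =>
    obtain rfl : k = t + d := by omega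
    rw [add_assoc t d 1, qBinom_add, qBinom_add, ← add_assoc t d 1, qnFact_succ q (t + d),
      qnFact_succ q d]
    have h1 := qnFact_q_ne_zero t
    have h2 := qnFact_q_ne_zero d
    have h4 := q_pow_sub_one_ne_zero d
    have h5 := q_sub_one_ne_zero
    field_simp

section

variable {A : Type*} [Ring A] [Algebra K A]

theorem Cq_mul (x : A) (c : ℤ) (n : ℕ) :
    Cq x c n * (q ^ (c - (n : ℤ)) • x - 1) = (q ^ (n + 1) - 1 : K) • Cq x c (n + 1) := by
  have h : q ^ ((n : ℤ) + 1) - 1 = q ^ (n + 1) - 1 := by norm_cast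
  rw [Cq, h, smul_inv_smul₀ (q_pow_sub_one_ne_zero n)]

theorem Cq_commute (x : A) (c : ℤ) (n : ℕ) : Commute (Cq x c n) x := by
  induction n with
  | zero => exact Commute.one_left x
  | succ n ih =>
    exact (ih.mul_left (((Commute.refl x).smul_left _).sub_left (Commute.one_left x))).smul_left _

theorem Cq_mul_shift (x : A) (c : ℤ) (n : ℕ) :
    Cq x c n * (q ^ (c + 1) • x - 1) = (q ^ (n + 1) - 1 : K) • Cq x (c + 1) (n + 1) := by
  rw [← Cq_mul]
  induction n with
  | zero => simp [Cq]
  | succ n ih =>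
    have e : c + 1 - ((n + 1 : ℕ) : ℤ) = c - n := by push_cast; ring
    have key : Cq x c (n + 1) = (q ^ (n + 1) - 1)⁻¹ • (Cq x c n * (q ^ (c - (n : ℤ)) • x - 1)) := by
      rw [Cq_mul, inv_smul_smul₀ (q_pow_sub_one_ne_zero n)]
    have hc : Commute (q ^ (c - (n : ℤ)) • x - 1) (q ^ (c + 1) • x - 1) :=
      ((((Commute.refl x).smul_left _).smul_right _).sub_right (Commute.one_right _)).sub_left
        (Commute.one_left _)
    rw [e, key, smul_mul_assoc, mul_assoc, hc.eq, ← mul_assoc, ih, Cq_mul, smul_mul_assoc,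
      inv_smul_smul₀ (q_pow_sub_one_ne_zero n)]

theorem Cq_pascal (x : A) (c : ℤ) (n : ℕ) :
    Cq x c n = Cq x (c + 1) (n + 1) - (q ^ (n + 1) : K) • Cq x c (n + 1) := by
  have h0 := q_pow_sub_one_ne_zero n
  have h1 := Cq_mul x c n
  have h2 := Cq_mul_shift x c n
  have e : q ^ (c + 1) = q ^ (n + 1) * q ^ (c - (n : ℤ)) := by
    rw [← zpow_natCast, ← zpow_add₀ q_ne_zero]
    congr 1
    push_cast
    ring
  have h3 : (q ^ (n + 1) - 1 : K) • Cq x c n =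
      Cq x c n * (q ^ (c + 1) • x - 1) -
        (q ^ (n + 1) : K) • (Cq x c n * (q ^ (c - (n : ℤ)) • x - 1)) := by
    rw [e]
    simp only [mul_sub, mul_smul_comm, mul_one, mul_smul, smul_sub, sub_smul, one_smul]
    abel
  rw [h1, h2, smul_comm, ← smul_sub] at h3
  exact smul_right_injective A h0 h3

theorem Cq_mul_general (x : A) (s : ℤ) (n t d : ℕ) :
    Cq x (s + t) n * (q ^ (s - (n : ℤ) + (t + d)) • x - 1) =
      (q ^ d - 1 : K) • Cq x (s + (t + 1 : ℕ)) (n + 1) +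
        (q ^ (n + 1) - q ^ d : K) • Cq x (s + t) (n + 1) := by
  have h1 := Cq_mul x (s + t) n
  have h2 := Cq_pascal x (s + t) n
  have e : q ^ (s - (n : ℤ) + (t + d)) = q ^ d * q ^ (s + t - (n : ℤ)) := by
    rw [← zpow_natCast, ← zpow_add₀ q_ne_zero]
    congr 1
    ring
  have h3 : Cq x (s + t) n * (q ^ (s - (n : ℤ) + (t + d)) • x - 1) =
      (q ^ d : K) • (Cq x (s + t) n * (q ^ (s + t - (n : ℤ)) • x - 1)) +
        (q ^ d - 1 : K) • Cq x (s + t) n := by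
    rw [e]
    simp only [mul_sub, mul_smul_comm, mul_one, mul_smul, smul_sub, sub_smul, one_smul]
    abel
  rw [h3, h1, h2, Nat.cast_add, Nat.cast_one, ← add_assoc s, smul_sub (q ^ d - 1), smul_smul, smul_smul,
    add_sub_left_comm, ← sub_smul]
  congr 2
  ring

end

theorem statement8 {A : Type*} [Ring A] [Algebra K A] (x : A) (m : ℕ) (s : ℤ)
    (j : ℕ) (hj1 : 1 ≤ j) (hjm : j ≤ m) :
    (q ^ j : K) • (Sq x s m j * (q ^ (s - (m : ℤ) + 2 * (j : ℤ)) • x - 1)) +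
      (q ^ (2 * j) - 1 : K) • Sq x s m (j - 1) =
    (q ^ (m + 1) - 1 : K) • Sq x s (m + 1) j := by
  obtain ⟨k, rfl⟩ : ∃ k, j = k + 1 := ⟨j - 1, by omega⟩
  obtain ⟨n, rfl⟩ : ∃ n, m = n + (k + 1) := ⟨m - (k + 1), by omega⟩
  set b : ℕ → K := fun t => q ^ (t * (t + 1) / 2) * qBinom q (k + 1) t with hb
  set D : ℕ → A := fun t => Cq x (s + (t : ℤ)) (n + 1)
  have hb_succ (t d : ℕ) (h : k + 1 = t + d) :
      b t * (q ^ d - 1) * q ^ (t + 1) = b (t + 1) * (q ^ (t + 1) - 1) := by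
    have hexp : (t + 1) * (t + 1 + 1) / 2 = t * (t + 1) / 2 + (t + 1) := by
      rw [show (t + 1) * (t + 1 + 1) = t * (t + 1) + (t + 1) * 2 by ring,
        Nat.add_mul_div_right _ _ two_pos]
    have hB := qBinom_mul_q_pow_sub_one t d
    rw [← h] at hB
    simp only [hb, hexp, pow_add q (t * (t + 1) / 2)]
    linear_combination q ^ (t * (t + 1) / 2) * q ^ (t + 1) * hB
  have hshift : ∑ t ∈ range (k + 2), (q ^ (k + 1) * b t * (q ^ (k + 1 - t) - 1)) • D (t + 1) =
      ∑ t ∈ range (k + 2), (q ^ (k + 1 - t) * b t * (q ^ t - 1)) • D t := by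
    rw [sum_range_succ, sum_range_succ' _ (k + 1)]
    simp only [Nat.sub_self, pow_zero, sub_self, mul_zero, zero_smul, add_zero]
    refine sum_congr rfl fun t ht => ?_
    obtain ⟨d, hd⟩ := Nat.exists_eq_add_of_le (Nat.lt_succ_iff.mp (mem_range.mp ht))
    have h := hb_succ t (d + 1) (by omega)
    rw [show k + 1 - t = d + 1 by omega, show k + 1 - (t + 1) = d by omega,
      show k + 1 = d + (t + 1) by omega]
    congr 1
    rw [pow_add q d (t + 1)]
    linear_combination q ^ d * h
  have hmul : (q ^ (k + 1) : K) • (Sq x s (n + (k + 1)) (k + 1) *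
        (q ^ (s - ((n + (k + 1) : ℕ) : ℤ) + 2 * ((k + 1 : ℕ) : ℤ)) • x - 1)) =
      ∑ t ∈ range (k + 2), (q ^ (k + 1) * b t * (q ^ (k + 1 - t) - 1)) • D (t + 1) +
      ∑ t ∈ range (k + 2), (q ^ (k + 1) * b t * (q ^ (n + 1) - q ^ (k + 1 - t))) • D t := by
    rw [Sq, sum_mul, smul_sum, ← sum_add_distrib]
    refine sum_congr rfl fun t ht => ?_
    obtain ⟨d, hd⟩ := Nat.exists_eq_add_of_le (Nat.lt_succ_iff.mp (mem_range.mp ht))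
    have hexp : s - ((n + (k + 1) : ℕ) : ℤ) + 2 * ((k + 1 : ℕ) : ℤ) = s - (n : ℤ) + (t + d) := by
      omega
    rw [hexp, Nat.add_sub_cancel, smul_mul_assoc, Cq_mul_general, show k + 1 - t = d by omega]
    rw [smul_add, smul_add, smul_smul, smul_smul, smul_smul, smul_smul]
  have hpred : Sq x s (n + (k + 1)) (k + 1 - 1) =
      ∑ t ∈ range (k + 2), (q ^ (t * (t + 1) / 2) * qBinom q k t) • D t := by
    rw [sum_range_succ, qBinom_self_succ, mul_zero, zero_smul, add_zero, Sq, Nat.add_sub_cancel,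
      show n + (k + 1) - k = n + 1 by omega]
  have hnext : Sq x s (n + (k + 1) + 1) (k + 1) = ∑ t ∈ range (k + 2), b t • D t := by
    rw [Sq, show n + (k + 1) + 1 - (k + 1) = n + 1 by omega]
  rw [hmul, hshift, hpred, hnext, smul_sum, smul_sum, ← sum_add_distrib, ← sum_add_distrib]
  refine sum_congr rfl fun t ht => ?_
  obtain ⟨d, hd⟩ := Nat.exists_eq_add_of_le (Nat.lt_succ_iff.mp (mem_range.mp ht))
  have hB := qBinom_pred_mul k t d hd
  rw [smul_smul, smul_smul, ← add_smul, ← add_smul, show k + 1 - t = d by omega]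
  congr 1
  have hq : q ^ (k + 1) = q ^ t * q ^ d := by rw [← pow_add, hd]
  have hn : q ^ (n + (k + 1) + 1) = q ^ (n + 1) * q ^ (k + 1) := by ring
  have h2 : q ^ (2 * (k + 1)) = q ^ (k + 1) * q ^ (k + 1) := by ring
  rw [hn, h2]
  simp only [hb]
  rw [hq] at hB ⊢
  linear_combination q ^ (t * (t + 1) / 2) * (q ^ t * q ^ d + 1) * hB
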